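/- Let X be a real Banach space and Y ⊆ X a closed linear subspace not containing any subspace isomorphic to ℓ₁. Let q : X → X/Y be the quotient operator, M ⊆ X a bounded set and ε ≥ 0. If q(M) is ε-weakly precompact in X/Y, then M is ε-weakly precompact in X. -/

import Mathlib

open Filter Topology

/-- `δ((x_n)) ≤ ε`: for every functional in the closed unit ball of the dual,
`limsup x*(x_n) − liminf x*(x_n) ≤ ε`. -/
def DeltaLE {E : Type*} [NormedAddCommGroup E] [NormedSpace ℝ E] (x : ℕ → E) (ε : ℝ) : Prop :=
  ∀ f : E →L[ℝ] ℝ, ‖f‖ ≤ 1 →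
    Filter.limsup (fun n => f (x n)) Filter.atTop
      - Filter.liminf (fun n => f (x n)) Filter.atTop ≤ ε

/-- A set `M` is `ε`-weakly precompact if it is bounded and every sequence in `M`
admits a subsequence `(x_{n_k})` with `δ((x_{n_k})) ≤ ε`. -/
def IsWeaklyPrecompactWith {E : Type*} [NormedAddCommGroup E] [NormedSpace ℝ E]
    (ε : ℝ) (M : Set E) : Prop :=
  Bornology.IsBounded M ∧
    ∀ x : ℕ → E, (∀ n, x n ∈ M) →
      ∃ φ : ℕ → ℕ, StrictMono φ ∧ DeltaLE (fun k => x (φ k)) ε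

/-- A Banach space `E` contains a subspace isomorphic to `ℓ₁` if some closed linear
subspace of `E` is isomorphic to `ℓ₁` via a continuous linear isomorphism. -/
def ContainsL1 (E : Type*) [NormedAddCommGroup E] [NormedSpace ℝ E] : Prop :=
  ∃ Z : Submodule ℝ E, IsClosed (Z : Set E) ∧
    Nonempty (lp (fun _ : ℕ => ℝ) 1 ≃L[ℝ] Z)


theorem diag_aux (P : ℕ → Set ℕ → Prop)
    (hmono : ∀ k N N', P k N → (N' \ N).Finite → P k N') (M : Set ℕ) (hM : M.Infinite)
    (h : ∀ k, ∀ N ⊆ M, N.Infinite → ∃ N' ⊆ N, N'.Infinite ∧ P k N') :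
    ∃ N ⊆ M, N.Infinite ∧ ∀ k, P k N := by
  choose! nx hsub hinf hP using h
  let G : ℕ → Set ℕ := fun n => Nat.rec M (fun k N => nx k N) n
  have hG0 : G 0 = M := rfl
  have hGs : ∀ k, G (k+1) = nx k (G k) := fun k => rfl
  have hG : ∀ k, G k ⊆ M ∧ (G k).Infinite := by
    intro k
    induction k with
    | zero => exact ⟨subset_rfl, hM⟩
    | succ k ih =>
      rw [hGs]
      exact ⟨(hsub k _ ih.1 ih.2).trans ih.1, hinf k _ ih.1 ih.2⟩
  have hanti : Antitone G := antitone_nat_of_succ_le fun k => by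
    rw [hGs]; exact hsub k _ (hG k).1 (hG k).2
  obtain ⟨φ, hφ, hφG⟩ := Filter.extraction_forall_of_frequently (P := fun n k => k ∈ G n)
    (fun n => Nat.frequently_atTop_iff_infinite.2 (hG n).2)
  refine ⟨Set.range φ, ?_, Set.infinite_range_of_injective hφ.injective, fun k => ?_⟩
  · rintro _ ⟨n, rfl⟩
    exact (hG n).1 (hφG n)
  · refine hmono k (G (k+1)) _ (hP k _ (hG k).1 (hG k).2) ?_
    refine ((Set.finite_Iio (k+1)).image φ).subset ?_
    rintro _ ⟨⟨n, rfl⟩, hn⟩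
    refine ⟨n, ?_, rfl⟩
    by_contra hlt
    exact hn (hanti (not_lt.1 hlt) (hφG n))

/-- Some point of `X` lies in infinitely many `A n` and infinitely many `B n`, `n ∈ N`. -/
def OscOn {S : Type*} (A B : ℕ → Set S) (X : Set S) (N : Set ℕ) : Prop :=
  ∃ x ∈ X, {n ∈ N | x ∈ A n}.Infinite ∧ {n ∈ N | x ∈ B n}.Infinite

theorem inf_mod_fin (p : ℕ → Prop) {N N' : Set ℕ} (h : {n ∈ N' | p n}.Infinite)
    (hf : (N' \ N).Finite) : {n ∈ N | p n}.Infinite := by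
  intro hfin
  refine h ((hfin.union hf).subset ?_)
  rintro n ⟨hn, hp⟩
  by_cases hN : n ∈ N
  · exact Or.inl ⟨hN, hp⟩
  · exact Or.inr ⟨hn, hN⟩

theorem OscOn.mod_fin {S : Type*} {A B : ℕ → Set S} {X : Set S} {N N' : Set ℕ}
    (h : OscOn A B X N') (hf : (N' \ N).Finite) : OscOn A B X N := by
  obtain ⟨x, hx, h1, h2⟩ := h
  exact ⟨x, hx, inf_mod_fin _ h1 hf, inf_mod_fin _ h2 hf⟩

/-- every infinite subset of `M` oscillates on `X` -/
def BadOn {S : Type*} (A B : ℕ → Set S) (X : Set S) (M : Set ℕ) : Prop :=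
  ∀ N ⊆ M, N.Infinite → OscOn A B X N

theorem rosenthal_step {S : Type*} (A B : ℕ → Set S) (F : Set (Set S)) (hF : F.Finite)
    (M : Set ℕ) (hM : M.Infinite) (hbad : ∀ X ∈ F, BadOn A B X M) :
    ∃ j ∈ M, ∃ M' ⊆ M, M'.Infinite ∧ (∀ n ∈ M', j < n) ∧
      ∀ X ∈ F, BadOn A B (X ∩ A j) M' ∧ BadOn A B (X ∩ B j) M' := by
  by_contra hcon
  let Q : ℕ → Set S × Bool → Set S := fun j p => p.1 ∩ (if p.2 then A j else B j)
  have key : ∀ j ∈ M, ∀ N ⊆ M, N.Infinite → ∃ N' ⊆ N, N'.Infinite ∧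
      ∃ p ∈ F ×ˢ (Set.univ : Set Bool), ¬ OscOn A B (Q j p) N' := by
    intro j hj N hN hNi
    by_contra hc
    push Not at hc
    apply hcon
    refine ⟨j, hj, N \ Set.Iic j, Set.sdiff_subset.trans hN, hNi.sdiff (Set.finite_Iic j), ?_, ?_⟩
    · rintro n ⟨_, hn⟩
      simpa using hn
    · intro X hX
      constructor
      · intro N' hN' hi
        simpa [Q] using hc N' (hN'.trans Set.sdiff_subset) hi (X, true) ⟨hX, trivial⟩
      · intro N' hN' hi
        simpa [Q] using hc N' (hN'.trans Set.sdiff_subset) hi (X, false) ⟨hX, trivial⟩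
  obtain ⟨N, hNM, hNi, hN⟩ := diag_aux
    (fun j N => j ∈ M → ∃ p ∈ F ×ˢ (Set.univ : Set Bool), ¬ OscOn A B (Q j p) N)
    (by
      intro k N N' h hf hk
      obtain ⟨p, hp, h⟩ := h hk
      exact ⟨p, hp, fun h' => h (h'.mod_fin hf)⟩) M hM
    (by
      intro k N hN hNi
      by_cases hk : k ∈ M
      · obtain ⟨N', h1, h2, h3⟩ := key k hk N hN hNi
        exact ⟨N', h1, h2, fun _ => h3⟩
      · exact ⟨N, subset_rfl, hNi, fun h => absurd h hk⟩)
  have hN' : ∀ j ∈ N, ∃ p ∈ F ×ˢ (Set.univ : Set Bool), ¬ OscOn A B (Q j p) N :=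
    fun j hj => hN j (hNM hj)
  choose! p hp hpN using hN'
  obtain ⟨q, hq, hqi⟩ : ∃ q ∈ F ×ˢ (Set.univ : Set Bool), {j ∈ N | p j = q}.Infinite := by
    by_contra hc
    push Not at hc
    refine hNi (((hF.prod Set.finite_univ).biUnion (t := fun q => {j ∈ N | p j = q}) ?_).subset ?_)
    · intro q hq
      simpa using hc q hq
    · intro j hj
      simp only [Set.mem_iUnion]
      exact ⟨p j, hp j hj, hj, rfl⟩
  obtain ⟨x, hx, h1, h2⟩ := hbad q.1 hq.1 {j ∈ N | p j = q} (fun j hj => hNM hj.1) hqi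
  have hsub : ∀ (C : ℕ → Set S), {n ∈ {j ∈ N | p j = q} | x ∈ C n} ⊆ {n ∈ N | x ∈ C n} :=
    fun C n hn => ⟨hn.1.1, hn.2⟩
  have fin : ∀ j ∈ N, p j = q → x ∈ (if q.2 then A j else B j) → False := by
    intro j hj hpj hxj
    apply hpN j hj
    rw [hpj]
    exact ⟨x, ⟨hx, hxj⟩, h1.mono (hsub A), h2.mono (hsub B)⟩
  cases hb : q.2
  · obtain ⟨j, hj⟩ := h2.nonempty
    exact fin j hj.1.1 hj.1.2 (by simpa [hb] using hj.2)
  · obtain ⟨j, hj⟩ := h1.nonempty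
    exact fin j hj.1.1 hj.1.2 (by simpa [hb] using hj.2)

/-- State of the Rosenthal construction. -/
structure RState {S : Type*} (A B : ℕ → Set S) (M : Set ℕ) where
  F : Set (Set S)
  N : Set ℕ
  finF : F.Finite
  sub : N ⊆ M
  inf : N.Infinite
  bad : ∀ X ∈ F, BadOn A B X N

theorem rosenthal_indep {S : Type*} (A B : ℕ → Set S) (X0 : Set S) (M : Set ℕ) (hM : M.Infinite)
    (hbad : BadOn A B X0 M) :
    ∃ j : ℕ → ℕ, StrictMono j ∧ ∀ (σ : ℕ → Bool) (n : ℕ), ∃ x ∈ X0, ∀ i < n,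
      x ∈ if σ i then A (j i) else B (j i) := by
  have step : ∀ st : RState A B M, ∃ (j : ℕ) (st' : RState A B M), j ∈ st.N ∧ st'.N ⊆ st.N ∧
      (∀ n ∈ st'.N, j < n) ∧ ∀ X ∈ st.F, X ∩ A j ∈ st'.F ∧ X ∩ B j ∈ st'.F := by
    intro st
    obtain ⟨j, hj, M', h1, h2, h3, h4⟩ := rosenthal_step A B st.F st.finF st.N st.inf st.bad
    refine ⟨j, ⟨(fun X => X ∩ A j) '' st.F ∪ (fun X => X ∩ B j) '' st.F, M',
      (st.finF.image _).union (st.finF.image _), h1.trans st.sub, h2, ?_⟩, hj, h1, h3, ?_⟩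
    · rintro _ (⟨X, hX, rfl⟩ | ⟨X, hX, rfl⟩)
      · exact (h4 X hX).1
      · exact (h4 X hX).2
    · intro X hX
      exact ⟨Or.inl ⟨X, hX, rfl⟩, Or.inr ⟨X, hX, rfl⟩⟩
  choose J nx hJ hsub hlt hF using step
  let st0 : RState A B M := ⟨{X0}, M, Set.finite_singleton _, subset_rfl, hM, by
    rintro X rfl; exact hbad⟩
  let G : ℕ → RState A B M := fun n => Nat.rec st0 (fun _ s => nx s) n
  have hGs : ∀ k, G (k+1) = nx (G k) := fun k => rfl
  refine ⟨fun k => J (G k), strictMono_nat_of_lt_succ fun k => ?_, fun σ n => ?_⟩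
  · exact hlt (G k) _ (hJ (G (k+1)))
  · have : ∃ X ∈ (G n).F, ∀ x ∈ X, x ∈ X0 ∧ ∀ i < n,
        x ∈ if σ i then A (J (G i)) else B (J (G i)) := by
      induction n with
      | zero => exact ⟨X0, rfl, fun x hx => ⟨hx, by simp⟩⟩
      | succ n ih =>
        obtain ⟨X, hX, h⟩ := ih
        refine ⟨X ∩ (if σ n then A (J (G n)) else B (J (G n))), ?_, ?_⟩
        · rw [hGs]
          cases σ n
          · simpa using (hF (G n) X hX).2
          · simpa using (hF (G n) X hX).1
        · rintro x ⟨hx, hx'⟩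
          refine ⟨(h x hx).1, fun i hi => ?_⟩
          rcases Nat.lt_succ_iff_lt_or_eq.1 hi with hi | rfl
          · exact (h x hx).2 i hi
          · exact hx'
    obtain ⟨X, hX, h⟩ := this
    obtain ⟨x, hx, -⟩ := (G n).bad X hX _ subset_rfl (G n).inf
    exact ⟨x, (h x hx).1, (h x hx).2⟩

theorem bdd_fun {E : Type*} [NormedAddCommGroup E] [NormedSpace ℝ E] {x : ℕ → E} {C : ℝ}
    (hx : ∀ n, ‖x n‖ ≤ C) (f : E →L[ℝ] ℝ) :
    IsBoundedUnder (· ≤ ·) atTop (fun n => f (x n)) ∧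
      IsBoundedUnder (· ≥ ·) atTop (fun n => f (x n)) := by
  have h : ∀ n, |f (x n)| ≤ ‖f‖ * C := fun n =>
    (f.le_opNorm (x n)).trans (mul_le_mul_of_nonneg_left (hx n) (norm_nonneg f))
  exact ⟨isBoundedUnder_of ⟨‖f‖ * C, fun n => (abs_le.1 (h n)).2⟩,
    isBoundedUnder_of ⟨-(‖f‖ * C), fun n => (abs_le.1 (h n)).1⟩⟩

theorem inf_image_aux {φ : ℕ → ℕ} (hφ : StrictMono φ) {N : Set ℕ} (hN : ∀ k, φ k ∈ N)
    {p : ℕ → Prop} (h : ∃ᶠ k in atTop, p (φ k)) : {n ∈ N | p n}.Infinite := by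
  refine ((Nat.frequently_atTop_iff_infinite.1 h).image hφ.injective.injOn).mono ?_
  rintro _ ⟨k, hk, rfl⟩
  exact ⟨hN k, hk⟩

theorem behrends_aux {E : Type*} [NormedAddCommGroup E] [NormedSpace ℝ E] {x : ℕ → E} {C : ℝ}
    (hx : ∀ n, ‖x n‖ ≤ C) {ε : ℝ}
    (h : ¬ ∃ φ : ℕ → ℕ, StrictMono φ ∧ DeltaLE (fun k => x (φ k)) ε) :
    ∃ r s : ℝ, ε < s - r ∧ ∃ j : ℕ → ℕ, StrictMono j ∧ ∀ σ : ℕ → Bool, ∃ f : E →L[ℝ] ℝ,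
      ‖f‖ ≤ 1 ∧ ∀ i, (σ i = true → s ≤ f (x (j i))) ∧ (σ i = false → f (x (j i)) ≤ r) := by
  let X0 : Set (WeakDual ℝ E) := WeakDual.toStrongDual ⁻¹' Metric.closedBall 0 1
  have hX0 : ∀ f : E →L[ℝ] ℝ, StrongDual.toWeakDual f ∈ X0 ↔ ‖f‖ ≤ 1 := by
    intro f
    simp [X0]
  let A : ℝ → ℕ → Set (WeakDual ℝ E) := fun s n => {f | s ≤ f (x n)}
  let B : ℝ → ℕ → Set (WeakDual ℝ E) := fun r n => {f | f (x n) ≤ r}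
  obtain ⟨r, s, hrs, M, hM, hbad⟩ : ∃ r s : ℝ, ε < s - r ∧ ∃ M : Set ℕ, M.Infinite ∧
      BadOn (A s) (B r) X0 M := by
    by_contra hcon
    obtain ⟨e, he⟩ := exists_surjective_nat (ℚ × ℚ)
    obtain ⟨N, -, hNi, hN⟩ := diag_aux (fun k N => ε < ((e k).2 : ℝ) - (e k).1 →
        ¬ OscOn (A (e k).2) (B (e k).1) X0 N)
      (fun k N N' h hf hk h' => h hk (h'.mod_fin hf)) Set.univ Set.infinite_univ
      (by
        intro k N _ hNi
        by_cases hk : ε < ((e k).2 : ℝ) - (e k).1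
        · by_contra hc
          apply hcon
          refine ⟨(e k).1, (e k).2, hk, N, hNi, fun N' hN' hi => ?_⟩
          by_contra hosc
          exact hc ⟨N', hN', hi, fun _ => hosc⟩
        · exact ⟨N, subset_rfl, hNi, fun h => absurd h hk⟩)
    obtain ⟨φ, hφ, hφN⟩ := extraction_of_frequently_atTop
      (Nat.frequently_atTop_iff_infinite.2 hNi)
    refine h ⟨φ, hφ, fun f hf => ?_⟩
    by_contra hlt
    push Not at hlt
    obtain ⟨hb1, hb2⟩ := bdd_fun (fun n => hx (φ n)) f
    set L := limsup (fun n => f (x (φ n))) atTop with hL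
    set l := liminf (fun n => f (x (φ n))) atTop with hl
    obtain ⟨s, hs1, hs2⟩ := exists_rat_btwn (show L - (L - l - ε) / 2 < L by linarith)
    obtain ⟨r, hr1, hr2⟩ := exists_rat_btwn (show l < l + (L - l - ε) / 2 by linarith)
    obtain ⟨k, hk⟩ := he (r, s)
    have := hN k
    rw [hk] at this
    refine this (by simp only; linarith) ⟨StrongDual.toWeakDual f, (hX0 f).2 hf, ?_, ?_⟩
    · refine inf_image_aux hφ hφN ?_
      exact (frequently_lt_of_lt_limsup hb2.isCoboundedUnder_le hs2).mono fun n hn => hn.le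
    · refine inf_image_aux hφ hφN ?_
      exact (frequently_lt_of_liminf_lt hb1.isCoboundedUnder_ge hr1).mono fun n hn => hn.le
  obtain ⟨j, hj, hind⟩ := rosenthal_indep (A s) (B r) X0 M hM hbad
  refine ⟨r, s, hrs, j, hj, fun σ => ?_⟩
  have hc := (WeakDual.isCompact_closedBall (𝕜 := ℝ) (E := E) 0 1).inter_iInter_nonempty
    (fun i => if σ i then A s (j i) else B r (j i))
    (by
      intro i
      cases σ i
      · simpa using isClosed_le (WeakDual.eval_continuous (x (j i))) continuous_const
      · simpa using isClosed_le continuous_const (WeakDual.eval_continuous (x (j i))))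
    (by
      intro u
      obtain ⟨f, hf, hfi⟩ := hind σ (u.sup id + 1)
      refine ⟨f, hf, ?_⟩
      simp only [Set.mem_iInter]
      intro i hi
      exact hfi i (Nat.lt_succ_of_le (Finset.le_sup (f := id) hi)))
  obtain ⟨f, hf, hfi⟩ := hc
  rw [Set.mem_iInter] at hfi
  refine ⟨WeakDual.toStrongDual f, by simpa using hf, fun i => ⟨fun h => ?_, fun h => ?_⟩⟩
  · have := hfi i
    rw [h] at this
    exact this
  · have := hfi i
    rw [h] at this
    exact this

theorem close_hulls {E : Type*} [NormedAddCommGroup E] [NormedSpace ℝ E] {z : ℕ → E} {C : ℝ}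
    (hz : ∀ n, ‖z n‖ ≤ C) {ε c : ℝ} (hε : 0 ≤ ε) (hc : ε < c) (hd : DeltaLE z ε)
    {φ ψ : ℕ → ℕ} (hφ : StrictMono φ) (hψ : StrictMono ψ) :
    ∃ u ∈ convexHull ℝ (Set.range (z ∘ φ)), ∃ v ∈ convexHull ℝ (Set.range (z ∘ ψ)),
      ‖u - v‖ < c := by
  by_contra hcon
  push Not at hcon
  have hc0 : 0 < c := by linarith
  let T : Set E := {w | ∃ u ∈ convexHull ℝ (Set.range (z ∘ φ)),
    ∃ v ∈ convexHull ℝ (Set.range (z ∘ ψ)), u - v = w}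
  have hT : Convex ℝ T :=
    (convex_convexHull ℝ (Set.range (z ∘ φ))).sub (convex_convexHull ℝ (Set.range (z ∘ ψ)))
  obtain ⟨f, u, h1, h2⟩ := geometric_hahn_banach_open (convex_ball (0 : E) c) Metric.isOpen_ball hT
    (by
      rw [Set.disjoint_left]
      rintro w hw ⟨a, ha, b, hb, rfl⟩
      rw [mem_ball_zero_iff] at hw
      exact absurd hw (not_lt.2 (hcon a ha b hb)))
  have hzz : ∀ m k, u ≤ f (z (φ m)) - f (z (ψ k)) := by
    intro m k
    rw [← map_sub]
    exact h2 _ ⟨_, subset_convexHull _ _ ⟨m, rfl⟩, _, subset_convexHull _ _ ⟨k, rfl⟩, rfl⟩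
  have hu : 0 < u := by simpa using h1 0 (by simpa using hc0)
  have hf0 : 0 < ‖f‖ := by
    rw [norm_pos_iff]
    rintro rfl
    have := hzz 0 0
    simp at this
    linarith
  have hfu : c * ‖f‖ ≤ u := by
    by_contra hlt
    push Not at hlt
    obtain ⟨y, hy1, hy2⟩ := f.exists_lt_apply_of_lt_opNorm (r := u / c) (by
      rw [div_lt_iff₀ hc0]; linarith)
    rw [div_lt_iff₀ hc0] at hy2
    have hb : ∀ t : ℝ, |t| = c → t • y ∈ Metric.ball (0 : E) c := by
      intro t ht
      rw [mem_ball_zero_iff, norm_smul, Real.norm_eq_abs, ht]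
      nlinarith
    have e1 := h1 _ (hb c (abs_of_pos hc0))
    have e2 := h1 _ (hb (-c) (by rw [abs_neg, abs_of_pos hc0]))
    simp only [map_smul, smul_eq_mul] at e1 e2
    rw [Real.norm_eq_abs] at hy2
    rcases abs_cases (f y) with ⟨h, _⟩ | ⟨h, _⟩ <;> rw [h] at hy2 <;> linarith
  let g : E →L[ℝ] ℝ := ‖f‖⁻¹ • f
  have hg : ‖g‖ ≤ 1 := by
    simp only [g, norm_smul, norm_inv, norm_norm]
    rw [inv_mul_cancel₀ hf0.ne']
  have hgz : ∀ m k, g (z (ψ k)) + c ≤ g (z (φ m)) := by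
    intro m k
    have := hfu.trans (hzz m k)
    have h3 : c ≤ ‖f‖⁻¹ * (f (z (φ m)) - f (z (ψ k))) := by
      rw [inv_mul_eq_div, le_div_iff₀ hf0]; exact this
    simp only [g, smul_apply, smul_eq_mul]
    linarith
  have hfin := hd g hg
  obtain ⟨hb1, hb2⟩ := bdd_fun hz g
  have hfreq : ∀ {p : ℕ → Prop} {θ : ℕ → ℕ}, StrictMono θ → (∀ k, p (θ k)) →
      ∃ᶠ n in atTop, p n := by
    intro p θ hθ hp
    exact hθ.tendsto_atTop.frequently (Eventually.frequently (Eventually.of_forall hp))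
  have hL : ∀ k, g (z (ψ k)) + c ≤ limsup (fun n => g (z n)) atTop := fun k =>
    le_limsup_of_frequently_le (hfreq hφ fun m => hgz m k) hb1
  have hl : liminf (fun n => g (z n)) atTop ≤ limsup (fun n => g (z n)) atTop - c :=
    liminf_le_of_frequently_le (hfreq hψ fun k => by linarith [hL k]) hb2
  linarith

theorem containsL1_of {E : Type*} [NormedAddCommGroup E] [NormedSpace ℝ E] [CompleteSpace E]
    {y : ℕ → E} {C c : ℝ} (hy : ∀ n, ‖y n‖ ≤ C) (hc : 0 < c)
    (h : ∀ a : ℕ → ℝ, Summable (fun n => |a n|) → c * ∑' n, |a n| ≤ ‖∑' n, a n • y n‖) :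
    ContainsL1 E := by
  have hs : ∀ a : lp (fun _ : ℕ => ℝ) 1, Summable (fun n => |a n|) := by
    intro a
    simpa using (lp.memℓp a).summable (by simp)
  have hn : ∀ a : lp (fun _ : ℕ => ℝ) 1, ‖a‖ = ∑' n, |a n| := by
    intro a
    simpa using lp.norm_eq_tsum_rpow (p := 1) (by simp) a
  have hle : ∀ (a : lp (fun _ : ℕ => ℝ) 1) n, ‖a n • y n‖ ≤ |a n| * C := by
    intro a n
    rw [norm_smul, Real.norm_eq_abs]
    exact mul_le_mul_of_nonneg_left (hy n) (abs_nonneg _)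
  have hsm : ∀ a : lp (fun _ : ℕ => ℝ) 1, Summable (fun n => a n • y n) := fun a =>
    Summable.of_norm_bounded ((hs a).mul_right C) (hle a)
  let T₀ : lp (fun _ : ℕ => ℝ) 1 →ₗ[ℝ] E :=
    { toFun := fun a => ∑' n, a n • y n
      map_add' := by
        intro a b
        rw [← (hsm a).tsum_add (hsm b)]
        simp [add_smul]
      map_smul' := by
        intro t a
        rw [RingHom.id_apply, ← (hsm a).tsum_const_smul]
        simp [mul_smul] }
  let T : lp (fun _ : ℕ => ℝ) 1 →L[ℝ] E := T₀.mkContinuous C (by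
    intro a
    rw [hn, mul_comm, ← tsum_mul_right]
    exact tsum_of_norm_bounded ((hs a).mul_right C).hasSum (hle a))
  have hT : ∀ a, c * ‖a‖ ≤ ‖T a‖ := fun a => by
    rw [hn]; exact h a (hs a)
  have hanti : AntilipschitzWith (Real.toNNReal c⁻¹) T := by
    refine AddMonoidHomClass.antilipschitz_of_bound T fun a => ?_
    rw [Real.coe_toNNReal _ (inv_nonneg.2 hc.le), inv_mul_eq_div, le_div_iff₀ hc, mul_comm]
    exact hT a
  have hcl : IsClosed (Set.range T) := hanti.isClosed_range T.uniformContinuous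
  exact ⟨T.range, hcl, ⟨T.equivRange hanti.injective hcl⟩⟩

theorem lohman_lifting_quantitative
    {X : Type*} [NormedAddCommGroup X] [NormedSpace ℝ X] [CompleteSpace X]
    (Y : Submodule ℝ X) [hY : IsClosed (Y : Set X)]
    (hl1 : ¬ ContainsL1 Y)
    (M : Set X) (hM : Bornology.IsBounded M) (ε : ℝ) (hε : 0 ≤ ε)
    (h : IsWeaklyPrecompactWith ε (Y.mkQ '' M)) :
    IsWeaklyPrecompactWith ε M := by
  refine ⟨hM, fun x0 hx0 => ?_⟩
  obtain ⟨φ, hφ, hδ⟩ := h.2 (fun n => Y.mkQ (x0 n)) (fun n => ⟨_, hx0 n, rfl⟩)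
  by_contra hcon
  obtain ⟨C, hC⟩ := hM.exists_norm_le
  have hx : ∀ n, ‖x0 (φ n)‖ ≤ C := fun n => hC _ (hx0 _)
  have hcon' : ¬ ∃ ψ : ℕ → ℕ, StrictMono ψ ∧ DeltaLE (fun k => (x0 ∘ φ) (ψ k)) ε := by
    rintro ⟨ψ, hψ, h⟩
    exact hcon ⟨φ ∘ ψ, hφ.comp hψ, h⟩
  obtain ⟨r, s, hrs, j, hj, hind⟩ := behrends_aux (x := x0 ∘ φ) hx hcon'
  obtain ⟨c, hc1, hc2⟩ := exists_between hrs
  have hz : ∀ n, ‖Y.mkQ (x0 (φ n))‖ ≤ C := fun n =>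
    (Submodule.Quotient.norm_mk_le Y _).trans (hx n)
  -- the block vectors
  have hblock : ∀ k, ∃ u ∈ convexHull ℝ (Set.range fun m => x0 (φ (j (Nat.pair k (2 * m))))),
      ∃ v ∈ convexHull ℝ (Set.range fun m => x0 (φ (j (Nat.pair k (2 * m + 1))))),
      ∃ y : Y, ‖(u - v) - y‖ < c := by
    intro k
    have hm : ∀ θ : ℕ → ℕ, StrictMono θ → StrictMono (fun m => j (Nat.pair k (θ m))) :=
      fun θ hθ => hj.comp fun a b hab => Nat.pair_lt_pair_right k (hθ hab)
    obtain ⟨u, hu, v, hv, huv⟩ := close_hulls hz hε hc1 hδ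
      (hm (fun m => 2 * m) (fun a b hab => by simp only; omega))
      (hm (fun m => 2 * m + 1) (fun a b hab => by simp only; omega))
    have himg : ∀ θ : ℕ → ℕ, Set.range ((fun n => Y.mkQ (x0 (φ n))) ∘ θ)
        = Y.mkQ '' Set.range (fun m => x0 (φ (θ m))) := by
      intro θ
      rw [← Set.range_comp]
      rfl
    rw [himg, ← LinearMap.image_convexHull] at hu hv
    obtain ⟨u, hu, rfl⟩ := hu
    obtain ⟨v, hv, rfl⟩ := hv
    refine ⟨u, hu, v, hv, ?_⟩
    rw [← map_sub] at huv
    obtain ⟨w, hw1, hw2⟩ := Submodule.Quotient.norm_mk_lt (S := Y) (Y.mkQ (u - v))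
      (sub_pos.2 huv)
    have hmem : (u - v) - w ∈ Y := by
      rw [← Submodule.Quotient.eq]
      exact hw1.symm
    refine ⟨⟨_, hmem⟩, ?_⟩
    simp only [sub_sub_cancel]
    linarith
  choose u hu v hv y hy using hblock
  have hball : ∀ g : ℕ → X, (∀ n, ‖g n‖ ≤ C) → ∀ w ∈ convexHull ℝ (Set.range g), ‖w‖ ≤ C := by
    intro g hg w hw
    have : convexHull ℝ (Set.range g) ⊆ Metric.closedBall 0 C :=
      convexHull_min (by rintro _ ⟨n, rfl⟩; simpa using hg n) (convex_closedBall _ _)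
    simpa using this hw
  have hyb : ∀ k, ‖y k‖ ≤ 2 * C + c := by
    intro k
    have h1 := hball _ (fun m => hx _) _ (hu k)
    have h2 := hball _ (fun m => hx _) _ (hv k)
    have h3 : ((y k : Y) : X) = (u k - v k) - ((u k - v k) - y k) := by abel
    have h4 : ‖((y k : Y) : X)‖ ≤ ‖u k - v k‖ + ‖(u k - v k) - y k‖ := by
      conv_lhs => rw [h3]
      exact norm_sub_le _ _
    have h5 := norm_sub_le (u k) (v k)
    have h6 := hy k
    rw [Submodule.coe_norm]
    linarith
  have : CompleteSpace Y := hY.completeSpace_coe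
  refine hl1 (containsL1_of (y := y) (c := (s - r) - c) hyb (sub_pos.2 hc2) fun a ha => ?_)
  obtain ⟨f, hf, hfi⟩ := hind fun i =>
    if (Nat.unpair i).2 % 2 = 0 then decide (0 ≤ a (Nat.unpair i).1)
      else !decide (0 ≤ a (Nat.unpair i).1)
  have hge : ∀ (t : ℝ) (g : ℕ → X), (∀ m, t ≤ f (g m)) → ∀ w ∈ convexHull ℝ (Set.range g),
      t ≤ f w := by
    intro t g hg w hw
    have : convexHull ℝ (Set.range g) ⊆ {w | t ≤ f w} :=
      convexHull_min (by rintro _ ⟨n, rfl⟩; exact hg n)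
        (convex_halfSpace_ge f.toLinearMap.isLinear t)
    exact this hw
  have hle : ∀ (t : ℝ) (g : ℕ → X), (∀ m, f (g m) ≤ t) → ∀ w ∈ convexHull ℝ (Set.range g),
      f w ≤ t := by
    intro t g hg w hw
    have : convexHull ℝ (Set.range g) ⊆ {w | f w ≤ t} :=
      convexHull_min (by rintro _ ⟨n, rfl⟩; exact hg n)
        (convex_halfSpace_le f.toLinearMap.isLinear t)
    exact this hw
  have hfy : ∀ k, f (u k - v k) - c ≤ f (y k) ∧ f (y k) ≤ f (u k - v k) + c := by
    intro k
    have h1 : |f ((u k - v k) - y k)| ≤ c := by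
      have := f.le_opNorm ((u k - v k) - y k)
      rw [Real.norm_eq_abs] at this
      have h2 := hy k
      nlinarith [norm_nonneg ((u k - v k) - (y k : X)), norm_nonneg f]
    rw [map_sub] at h1
    have := abs_le.1 h1
    constructor <;> linarith
  have hterm : ∀ k, |a k| * ((s - r) - c) ≤ a k * f (y k) := by
    intro k
    by_cases hk : 0 ≤ a k
    · have h1 : s ≤ f (u k) := hge s _ (fun m => (hfi _).1 (by simp [hk])) _ (hu k)
      have h2 : f (v k) ≤ r := hle r _ (fun m => (hfi _).2 (by simp [hk])) _ (hv k)
      have h3 := (hfy k).1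
      rw [map_sub] at h3
      rw [abs_of_nonneg hk]
      exact mul_le_mul_of_nonneg_left (by linarith) hk
    · have h1 : f (u k) ≤ r := hle r _ (fun m => (hfi _).2 (by simpa using hk)) _ (hu k)
      have h2 : s ≤ f (v k) := hge s _ (fun m => (hfi _).1 (by simpa using hk)) _ (hv k)
      have h3 := (hfy k).2
      rw [map_sub] at h3
      push Not at hk
      rw [abs_of_neg hk]
      nlinarith
  have hsm : Summable fun n => a n • y n :=
    Summable.of_norm_bounded (ha.mul_right (2 * C + c)) fun n => by
      rw [norm_smul, Real.norm_eq_abs]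
      exact mul_le_mul_of_nonneg_left (hyb n) (abs_nonneg _)
  let F : Y →L[ℝ] ℝ := f.comp Y.subtypeL
  have hsum : HasSum (fun n => a n * f (y n)) (F (∑' n, a n • y n)) := by
    have := hsm.hasSum.mapL F
    simpa [F] using this
  have h1 : ((s - r) - c) * ∑' n, |a n| ≤ F (∑' n, a n • y n) := by
    rw [mul_comm, ← tsum_mul_right]
    exact hasSum_le hterm (ha.mul_right _).hasSum hsum
  refine h1.trans ?_
  have h2 : F (∑' n, a n • y n) ≤ ‖f‖ * ‖∑' n, a n • y n‖ :=
    (le_abs_self _).trans (f.le_opNorm _)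
  exact h2.trans (mul_le_of_le_one_left (norm_nonneg _) hf)
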